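/- Let k and n be positive integers with μ(n) > k. Then every homogeneous polynomial of degree n in P_k is hit; equivalently, (QP_k)_n = 0. -/

import Mathlib

/-- `μ(n)`: the smallest `r` such that `n` can be written as a sum of `r` numbers
of the form `2^d - 1` with `d > 0`. -/
noncomputable def muNat (n : ℕ) : ℕ :=
  sInf {r : ℕ | ∃ d : Fin r → ℕ, (∀ i, 0 < d i) ∧ n = ∑ i, (2 ^ d i - 1)}

open MvPolynomial

/-- The total Steenrod square on `P_k = F_2[x_1,…,x_k]`, the algebra map with
`Sq(x_j) = x_j + x_j^2`. -/
noncomputable def SqTotal (k : ℕ) :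
    MvPolynomial (Fin k) (ZMod 2) →ₐ[ZMod 2] MvPolynomial (Fin k) (ZMod 2) :=
  aeval fun j => X j + X j ^ 2

/-- The Steenrod square `Sq^i : P_k → P_k`, sending a homogeneous polynomial `f` of
degree `d` to the degree-`d + i` homogeneous component of `Sq(f)`, extended additively. -/
noncomputable def SqOp (k i : ℕ) (f : MvPolynomial (Fin k) (ZMod 2)) :
    MvPolynomial (Fin k) (ZMod 2) :=
  ∑ d ∈ Finset.range (f.totalDegree + 1),
    homogeneousComponent (d + i) (SqTotal k (homogeneousComponent d f))

/-- The space of hit polynomials: finite sums of `Sq^i (f_i)` with `i > 0`. -/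
noncomputable def hitSubmodule (k : ℕ) :
    Submodule (ZMod 2) (MvPolynomial (Fin k) (ZMod 2)) :=
  Submodule.span (ZMod 2) {g | ∃ i f, 0 < i ∧ g = SqOp k i f}

/-- A polynomial is hit if it is a finite sum of `Sq^i (f_i)` with `i > 0`. -/
def IsHit (k : ℕ) (f : MvPolynomial (Fin k) (ZMod 2)) : Prop := f ∈ hitSubmodule k

/-- `(QP_k)_n`: the space of homogeneous polynomials of degree `n` modulo hit polynomials. -/
abbrev QP (k n : ℕ) :=
  ↥(homogeneousSubmodule (Fin k) (ZMod 2) n) ⧸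
    ((hitSubmodule k).comap (homogeneousSubmodule (Fin k) (ZMod 2) n).subtype)

section Homogeneous

variable {σ R : Type*} [CommSemiring R]

attribute [local instance] MvPolynomial.gradedAlgebra in
theorem homogeneousComponent_add_mul_of_isHomogeneous {p : MvPolynomial σ R} {a : ℕ}
    (hp : p.IsHomogeneous a) (b : ℕ) (q : MvPolynomial σ R) :
    homogeneousComponent (a + b) (p * q) = p * homogeneousComponent b q := by
  have := DirectSum.coe_decompose_mul_add_of_left_mem (homogeneousSubmodule σ R) (i := a) (j := b)
    (b := q) hp
  rwa [← DirectSum.Decomposition.decompose'_eq, decomposition.decompose'_apply,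
    decomposition.decompose'_apply] at this

attribute [local instance] MvPolynomial.gradedAlgebra in
theorem homogeneousComponent_mul_of_isHomogeneous_of_lt {p : MvPolynomial σ R} {a j : ℕ}
    (hp : p.IsHomogeneous a) (hj : j < a) (q : MvPolynomial σ R) :
    homogeneousComponent j (p * q) = 0 := by
  have := DirectSum.coe_decompose_mul_of_left_mem_of_not_le (homogeneousSubmodule σ R)
    (b := q) hp (not_le.2 hj)
  rwa [← DirectSum.Decomposition.decompose'_eq, decomposition.decompose'_apply] at this

theorem homogeneousComponent_add_mul_of_totalDegree_le {p q : MvPolynomial σ R} {a b : ℕ}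
    (hp : p.totalDegree ≤ a) (hq : q.totalDegree ≤ b) :
    homogeneousComponent (a + b) (p * q) =
      homogeneousComponent a p * homogeneousComponent b q := by
  have hsum : p = ∑ i ∈ Finset.range (a + 1), homogeneousComponent i p := by
    conv_lhs => rw [← sum_homogeneousComponent p]
    refine Finset.sum_subset (Finset.range_mono (by lia)) fun i _ hi => ?_
    exact homogeneousComponent_eq_zero _ _ (by simpa using hi)
  conv_lhs => rw [hsum, Finset.sum_mul, map_sum]
  rw [Finset.sum_eq_single a]
  · exact homogeneousComponent_add_mul_of_isHomogeneous (homogeneousComponent_isHomogeneous a p) b q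
  · intro i hi hia
    have hi : i ≤ a := by simpa [Nat.lt_succ_iff] using hi
    obtain ⟨c, hc⟩ : ∃ c, a + b = i + c := ⟨a + b - i, by lia⟩
    rw [hc, homogeneousComponent_add_mul_of_isHomogeneous (homogeneousComponent_isHomogeneous i p),
      homogeneousComponent_eq_zero c q (by lia), mul_zero]
  · simp

theorem homogeneousComponent_prod_of_totalDegree_le {ι : Type*} (s : Finset ι)
    (p : ι → MvPolynomial σ R) (a : ι → ℕ) (h : ∀ i ∈ s, (p i).totalDegree ≤ a i) :
    homogeneousComponent (∑ i ∈ s, a i) (∏ i ∈ s, p i) =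
      ∏ i ∈ s, homogeneousComponent (a i) (p i) := by
  classical
  induction s using Finset.induction_on with
  | empty => simp [homogeneousComponent_zero]
  | insert i s hi ih =>
    rw [Finset.sum_insert hi, Finset.prod_insert hi, Finset.prod_insert hi,
      homogeneousComponent_add_mul_of_totalDegree_le (h i (by simp)),
      ih fun j hj => h j (by simp [hj])]
    exact (totalDegree_finsetProd s p).trans
      (Finset.sum_le_sum fun j hj => h j (by simp [hj]))

theorem homogeneousComponent_one_add_X_pow [Nontrivial R] (i : σ) (a : ℕ) :
    homogeneousComponent a ((1 + X i : MvPolynomial σ R) ^ a) = X i ^ a := by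
  have h := homogeneousComponent_prod_of_totalDegree_le (Finset.range a)
    (fun _ => (1 + X i : MvPolynomial σ R)) (fun _ => 1)
    fun _ _ => (totalDegree_add _ _).trans (by simp)
  have h1 : homogeneousComponent 1 (X i : MvPolynomial σ R) = X i :=
    homogeneousComponent_eq_self (isHomogeneous_X R i)
  have h2 : homogeneousComponent 1 (1 : MvPolynomial σ R) = 0 :=
    homogeneousComponent_eq_zero _ _ (by simp)
  simpa [h1, h2] using h

theorem homogeneousComponent_eq_zero_of_mem_pow_idealOfVars {R : Type*} [CommRing R]
    {p : MvPolynomial σ R} {N n : ℕ} (hp : p ∈ idealOfVars σ R ^ N) (hn : n < N) :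
    homogeneousComponent n p = 0 := by
  rw [mem_pow_idealOfVars_iff'] at hp
  ext d
  rw [coeff_homogeneousComponent, coeff_zero]
  split_ifs with hd
  · exact hp d (by lia)
  · rfl

theorem Ideal.prod_add_sub_prod_mem {A ι : Type*} [CommRing A] (I : Ideal A) (s : Finset ι)
    (x y : ι → A) (hy : ∀ i ∈ s, y i ∈ I) : ∏ i ∈ s, (x i + y i) - ∏ i ∈ s, x i ∈ I := by
  rw [← Ideal.Quotient.eq, map_prod, map_prod]
  refine Finset.prod_congr rfl fun i hi => ?_
  rw [map_add, Ideal.Quotient.eq_zero_iff_mem.2 (hy i hi), add_zero]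

end Homogeneous

section Steenrod

variable {k : ℕ}

theorem SqTotal_X (i : Fin k) : SqTotal k (X i) = X i + X i ^ 2 := by
  simp [SqTotal]

theorem SqTotal_monomial (v : Fin k →₀ ℕ) (c : ZMod 2) :
    SqTotal k (monomial v c) = monomial v c * ∏ i, (1 + X i) ^ v i := by
  rw [SqTotal, aeval_monomial, monomial_eq, mul_assoc,
    Finsupp.prod_fintype _ _ (by simp), Finsupp.prod_fintype _ _ (by simp),
    ← Finset.prod_mul_distrib, algebraMap_eq]
  congr 1
  refine Finset.prod_congr rfl fun i _ => ?_
  rw [← mul_pow]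
  ring

theorem homogeneousComponent_SqTotal {d : ℕ} {q : MvPolynomial (Fin k) (ZMod 2)}
    (hq : q.IsHomogeneous d) : homogeneousComponent d (SqTotal k q) = q := by
  conv_lhs => rw [q.as_sum]
  conv_rhs => rw [q.as_sum]
  rw [map_sum, map_sum]
  refine Finset.sum_congr rfl fun v hv => ?_
  have hv' : (monomial v (coeff v q)).IsHomogeneous d :=
    isHomogeneous_monomial _ (hq.degree_eq_sum_deg_support hv).symm
  have := homogeneousComponent_add_mul_of_isHomogeneous hv' 0 (∏ i, (1 + X i) ^ v i)
  rw [SqTotal_monomial]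
  simpa [homogeneousComponent_zero, ← constantCoeff_eq] using this

theorem homogeneousComponent_SqTotal_of_lt {d j : ℕ} {q : MvPolynomial (Fin k) (ZMod 2)}
    (hq : q.IsHomogeneous d) (hj : j < d) : homogeneousComponent j (SqTotal k q) = 0 := by
  rw [q.as_sum, map_sum, map_sum]
  refine Finset.sum_eq_zero fun v hv => ?_
  rw [SqTotal_monomial]
  exact homogeneousComponent_mul_of_isHomogeneous_of_lt
    (isHomogeneous_monomial _ (hq.degree_eq_sum_deg_support hv).symm) hj _

theorem SqOp_of_isHomogeneous {d i : ℕ} {q : MvPolynomial (Fin k) (ZMod 2)}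
    (hq : q.IsHomogeneous d) :
    SqOp k i q = homogeneousComponent (d + i) (SqTotal k q) := by
  by_cases h0 : q = 0
  · simp [SqOp, h0]
  rw [SqOp, Finset.sum_eq_single d]
  · rw [homogeneousComponent_eq_self hq]
  · intro b _ hb
    rw [homogeneousComponent_of_mem hq, if_neg hb]
    simp
  · intro h
    exact absurd (by simp [hq.totalDegree h0]) h

/-- Modulo hits, only the degree-`n` part of `h` contributes to the degree-`n` part of `Sq h`. -/
theorem homogeneousComponent_SqTotal_sub_mem_hitSubmodule (n : ℕ)
    (h : MvPolynomial (Fin k) (ZMod 2)) :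
    homogeneousComponent n (SqTotal k h) - homogeneousComponent n h ∈ hitSubmodule k := by
  have key : ∀ d, homogeneousComponent n (SqTotal k (homogeneousComponent d h)) -
      homogeneousComponent n (homogeneousComponent d h) ∈ hitSubmodule k := by
    intro d
    have hd := homogeneousComponent_isHomogeneous d h
    rcases lt_trichotomy n d with hnd | rfl | hnd
    · rw [homogeneousComponent_SqTotal_of_lt hd hnd, homogeneousComponent_of_mem hd,
        if_neg hnd.ne, sub_zero]
      exact zero_mem _
    · rw [homogeneousComponent_SqTotal hd, homogeneousComponent_eq_self hd, sub_self]
      exact zero_mem _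
    · rw [homogeneousComponent_of_mem hd, if_neg hnd.ne', sub_zero]
      refine Submodule.subset_span ⟨n - d, homogeneousComponent d h, by lia, ?_⟩
      rw [SqOp_of_isHomogeneous hd, Nat.add_sub_cancel' hnd.le]
  have hsum := Submodule.sum_mem (hitSubmodule k)
    (t := Finset.range (h.totalDegree + 1)) fun d _ => key d
  rwa [Finset.sum_sub_distrib, ← map_sum, ← map_sum, ← map_sum, sum_homogeneousComponent] at hsum

theorem homogeneousComponent_SqTotal_monomial_two_mul (w : Fin k →₀ ℕ) :
    homogeneousComponent (∑ i, w i + ∑ i, w i) (SqTotal k (monomial w 1)) =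
      monomial w 1 * monomial w 1 := by
  have hw : (monomial w (1 : ZMod 2)).IsHomogeneous (∑ i, w i) :=
    isHomogeneous_monomial _ (Finsupp.degree_eq_sum w)
  rw [SqTotal_monomial, homogeneousComponent_add_mul_of_isHomogeneous hw,
    homogeneousComponent_prod_of_totalDegree_le]
  · simp_rw [homogeneousComponent_one_add_X_pow]
    rw [monomial_eq, Finsupp.prod_fintype _ _ (by simp), C_1, one_mul]
  · intro i _
    refine (totalDegree_pow _ _).trans ?_
    have : (1 + X i : MvPolynomial (Fin k) (ZMod 2)).totalDegree ≤ 1 :=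
      (totalDegree_add _ _).trans (by simp)
    nlinarith

theorem SqTotal_sum_X_two_pow (i : Fin k) (N : ℕ) :
    SqTotal k (∑ t ∈ Finset.range N, X i ^ 2 ^ t) = X i + X i ^ 2 ^ N := by
  induction N with
  | zero => simp [CharTwo.add_self_eq_zero]
  | succ N ih =>
    have : (X i + X i ^ 2 : MvPolynomial (Fin k) (ZMod 2)) ^ 2 ^ N =
        X i ^ 2 ^ N + X i ^ 2 ^ (N + 1) := by
      rw [add_pow_char_pow, ← pow_mul, ← pow_succ']
    rw [Finset.sum_range_succ, map_add, ih, map_pow, SqTotal_X, this,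
      add_assoc, CharTwo.add_cancel_left]

theorem muNat_le_card {ι : Type*} (S : Finset ι) (τ : ∀ i ∈ S, ℕ) (n : ℕ)
    (h : n + S.card = 2 * ∑ i ∈ S.attach, 2 ^ τ i i.2) : muNat n ≤ S.card := by
  refine Nat.sInf_le ⟨fun j => τ (S.equivFin.symm j) (S.equivFin.symm j).2 + 1,
    fun _ => Nat.succ_pos _, ?_⟩
  rw [Equiv.sum_comp S.equivFin.symm fun i : S => 2 ^ (τ i i.2 + 1) - 1]
  have : ∑ i : S, (2 ^ (τ i i.2 + 1) - 1) + S.card = n + S.card := by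
    rw [h, ← Finset.card_attach, Finset.card_eq_sum_ones, Finset.mul_sum,
      ← Finset.univ_eq_attach, ← Finset.sum_add_distrib]
    refine Finset.sum_congr rfl fun i _ => ?_
    have := Nat.one_le_two_pow (n := τ i i.2 + 1)
    rw [pow_succ] at *
    lia
  lia

theorem homogeneousComponent_prod_sum_X_two_pow_eq_zero (S : Finset (Fin k)) (N n m : ℕ)
    (hn : n + S.card = 2 * m) (h : S.card < muNat n) :
    homogeneousComponent m
      (∏ i ∈ S, ∑ t ∈ Finset.range N, (X i : MvPolynomial (Fin k) (ZMod 2)) ^ 2 ^ t) = 0 := by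
  rw [Finset.prod_sum, map_sum]
  refine Finset.sum_eq_zero fun τ _ => ?_
  have hτ : (∏ x ∈ S.attach,
      (X x.1 : MvPolynomial (Fin k) (ZMod 2)) ^ 2 ^ τ x.1 x.2).IsHomogeneous
      (∑ x ∈ S.attach, 2 ^ τ x.1 x.2) :=
    IsHomogeneous.prod _ _ _ fun x _ => isHomogeneous_X_pow _ _
  rw [homogeneousComponent_of_mem hτ, if_neg]
  rintro rfl
  exact h.not_ge (muNat_le_card S τ n hn)

theorem monomial_mem_hitSubmodule {n : ℕ} (h : k < muNat n) (v : Fin k →₀ ℕ)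
    (hv : v.degree = n) : monomial v (1 : ZMod 2) ∈ hitSubmodule k := by
  set S : Finset (Fin k) := Finset.univ.filter fun i => v i % 2 = 1 with hS
  set w : Fin k →₀ ℕ := Finsupp.equivFunOnFinite.symm fun i => v i / 2 with hw
  have hcard : S.card = ∑ i, v i % 2 := by
    rw [hS, Finset.card_filter]
    refine Finset.sum_congr rfl fun i _ => ?_
    split_ifs <;> lia
  have hdeg : n = S.card + (∑ i, w i + ∑ i, w i) := by
    rw [← hv, Finsupp.degree_eq_sum, hcard, ← Finset.sum_add_distrib, ← Finset.sum_add_distrib]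
    refine Finset.sum_congr rfl fun i _ => ?_
    simp only [hw, Finsupp.equivFunOnFinite_symm_apply_apply]
    lia
  have hmon : monomial v (1 : ZMod 2) = (∏ i ∈ S, X i) * (monomial w 1 * monomial w 1) := by
    simp only [monomial_eq, C_1, one_mul]
    rw [Finsupp.prod_fintype _ _ (by simp), Finsupp.prod_fintype _ _ (by simp), hS,
      Finset.prod_filter, ← Finset.prod_mul_distrib, ← Finset.prod_mul_distrib]
    refine Finset.prod_congr rfl fun i _ => ?_
    simp only [hw, Finsupp.equivFunOnFinite_symm_apply_apply]
    rw [← pow_add]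
    split_ifs with hi
    · rw [← pow_succ']
      congr 1
      lia
    · rw [one_mul]
      congr 1
      lia
  have hX : (∏ i ∈ S, X i : MvPolynomial (Fin k) (ZMod 2)).IsHomogeneous S.card := by
    simpa using IsHomogeneous.prod S (fun i => (X i : MvPolynomial (Fin k) (ZMod 2)))
      (fun _ => 1) fun i _ => isHomogeneous_X _ i
  have hwh : (monomial w (1 : ZMod 2)).IsHomogeneous (∑ i, w i) :=
    isHomogeneous_monomial _ (Finsupp.degree_eq_sum w)
  set E : MvPolynomial (Fin k) (ZMod 2) := ∏ i ∈ S, ∑ t ∈ Finset.range n, X i ^ 2 ^ t with hE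
  have hlow : homogeneousComponent n (monomial w 1 * E) = 0 := by
    rw [show n = ∑ i, w i + (S.card + ∑ i, w i) by lia,
      homogeneousComponent_add_mul_of_isHomogeneous hwh,
      homogeneousComponent_prod_sum_X_two_pow_eq_zero S n n _ (by lia)
        (lt_of_le_of_lt (by simpa using Finset.card_le_univ S) h), mul_zero]
  have hSq : homogeneousComponent n (SqTotal k (monomial w 1 * E)) = monomial v 1 := by
    have hmem := Ideal.prod_add_sub_prod_mem (idealOfVars (Fin k) (ZMod 2) ^ 2 ^ n) S X
      (fun i => X i ^ 2 ^ n) fun i _ =>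
        Ideal.pow_mem_pow (Ideal.subset_span (Set.mem_range_self i)) _
    have hzero := homogeneousComponent_eq_zero_of_mem_pow_idealOfVars
      (Ideal.mul_mem_right (SqTotal k (monomial w 1)) _ hmem) (Nat.lt_two_pow_self (n := n))
    rw [sub_mul, map_sub, sub_eq_zero] at hzero
    rw [map_mul, hE, map_prod, mul_comm]
    simp_rw [SqTotal_sum_X_two_pow]
    rw [hzero, hmon, ← homogeneousComponent_SqTotal_monomial_two_mul,
      ← homogeneousComponent_add_mul_of_isHomogeneous hX, ← hdeg]
  have := homogeneousComponent_SqTotal_sub_mem_hitSubmodule n (monomial w 1 * E)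
  rwa [hlow, hSq, sub_zero] at this

end Steenrod

/-- Wood's theorem (Peterson's conjecture): if `μ(n) > k` then every homogeneous
polynomial of degree `n` in `P_k` is hit; equivalently `(QP_k)_n = 0`. -/
theorem stmt2 (k n : ℕ) (hk : 0 < k) (hn : 0 < n) (h : k < muNat n) :
    (∀ f ∈ homogeneousSubmodule (Fin k) (ZMod 2) n, IsHit k f) ∧
      Subsingleton (QP k n) := by
  have hit : ∀ f ∈ homogeneousSubmodule (Fin k) (ZMod 2) n, IsHit k f := by
    intro f hf
    rw [IsHit, f.as_sum]
    refine Submodule.sum_mem _ fun v hv => ?_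
    have hmem := monomial_mem_hitSubmodule h v
      (IsHomogeneous.degree_eq_sum_deg_support hf hv).symm
    simpa [smul_monomial] using Submodule.smul_mem _ (coeff v f) hmem
  refine ⟨hit, ?_⟩
  rw [Submodule.Quotient.subsingleton_iff, eq_top_iff]
  exact fun f _ => hit f f.2
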